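/- Assume condition (i) fails, i.e., (c_0 + d_0 − 2a_0)(d_0 − a_0) ≠ a_0 c_0. Then there exists δ > 0 such that for μ_f-a.e. x ∈ [0, 1): limsup_{N→∞} (1/N) Σ_{n=1}^N s(p_0(r_n(x)/s_n(x))) ≤ log 2 − δ. (One may take δ = (log 2 − e_0) p_0(α)/2, where e_0 = s(p_0(γ − 2 + ε_0)) < log 2 and ε_0 ∈ (0, 2(γ − 1)) is chosen so that |z − (γ − 2)| ≤ ε_0 implies |Φ(ᵗA_0; z) − (γ − 2)| > ε_0.) -/

import Mathlib

open MeasureTheory Filter Set Matrix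

noncomputable def Phi (a b c d z : ℝ) : ℝ := (a * z + b) / (c * z + d)

noncomputable def PhiM (M : Matrix (Fin 2) (Fin 2) ℝ) (z : ℝ) : ℝ :=
  (M 0 0 * z + M 0 1) / (M 1 0 * z + M 1 1)

noncomputable def entS (p : ℝ) : ℝ := -(p * Real.log p) - (1 - p) * Real.log (1 - p)

noncomputable def Xdig (x : ℝ) (n : ℕ) : ℕ :=
  ⌊(2 : ℝ) ^ n * x⌋₊ - 2 * ⌊(2 : ℝ) ^ (n - 1) * x⌋₊

noncomputable def dyadI (x : ℝ) (n : ℕ) : Set ℝ :=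
  Set.Ico ((⌊(2 : ℝ) ^ n * x⌋₊ : ℝ) / 2 ^ n) (((⌊(2 : ℝ) ^ n * x⌋₊ : ℝ) + 1) / 2 ^ n)

noncomputable def matProd (A : ℕ → Matrix (Fin 2) (Fin 2) ℝ) (x : ℝ) (n : ℕ) :
    Matrix (Fin 2) (Fin 2) ℝ :=
  ((List.range n).map (fun j => A (Xdig x (j + 1)))).prod

noncomputable def Fcal (n : ℕ) : MeasurableSpace ℝ :=
  ⨆ i ∈ Finset.Icc 1 n, MeasurableSpace.comap (fun x : ℝ => Xdig x i) ⊤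

noncomputable def Rfun (μf : Measure ℝ) (x : ℝ) (n : ℕ) : ℝ :=
  if n = 0 then 1 else (μf (dyadI x n)).toReal

/-- The ratio `r_n(x) / s_n(x)` of the bottom row of the matrix product. -/
noncomputable def rowRatio (A : ℕ → Matrix (Fin 2) (Fin 2) ℝ) (x : ℝ) (n : ℕ) : ℝ :=
  matProd A x n 1 0 / matProd A x n 1 1

lemma matProd_succ (A : ℕ → Matrix (Fin 2) (Fin 2) ℝ) (x : ℝ) (n : ℕ) :
    matProd A x (n + 1) = matProd A x n * A (Xdig x (n + 1)) := by
  simp [matProd, List.range_succ]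

lemma measurable_Xdig (n : ℕ) : Measurable (fun x : ℝ => Xdig x n) := by
  unfold Xdig
  exact ((measurable_const_mul _).nat_floor).sub
    (((measurable_const_mul _).nat_floor).const_mul 2)

lemma measurable_matProd (A : ℕ → Matrix (Fin 2) (Fin 2) ℝ) (n : ℕ) (i k : Fin 2) :
    Measurable (fun x : ℝ => matProd A x n i k) := by
  induction n generalizing k with
  | zero => simp [matProd]
  | succ n ih =>
    have hA : ∀ l k, Measurable (fun x : ℝ => A (Xdig x (n + 1)) l k) := fun l k =>
      (measurable_from_top (f := fun e : ℕ => A e l k)).comp (measurable_Xdig (n + 1))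
    simp only [matProd_succ, Matrix.mul_apply, Fin.sum_univ_two]
    exact ((ih 0).mul (hA 0 k)).add ((ih 1).mul (hA 1 k))

lemma measurable_rowRatio (A : ℕ → Matrix (Fin 2) (Fin 2) ℝ) (n : ℕ) :
    Measurable (fun x : ℝ => rowRatio A x n) :=
  (measurable_matProd A n 1 0).div (measurable_matProd A n 1 1)

lemma PhiM_mul (M B : Matrix (Fin 2) (Fin 2) ℝ) (y : ℝ) (h : B 1 0 * y + B 1 1 ≠ 0) :
    PhiM (M * B) y = PhiM M (PhiM B y) := by
  unfold PhiM
  rw [← mul_div_mul_right (M 0 0 * _ + M 0 1) _ h]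
  simp only [Matrix.mul_apply, Fin.sum_univ_two]
  congr 1 <;> (field_simp; ring)

/-- The features of a normalized system of de Rham equations used below. -/
structure DeRhamSystem (A : ℕ → Matrix (Fin 2) (Fin 2) ℝ) (f : ℝ → ℝ) (γ α : ℝ) : Prop where
  eqn : ∀ e : ℕ, e < 2 → ∀ t ∈ Icc (0 : ℝ) 1, f ((e + t) / 2) = PhiM (A e) (f t)
  den : ∀ e : ℕ, e < 2 → ∀ y ∈ Icc (0 : ℝ) 1, 0 < A e 1 0 * y + A e 1 1
  maps : ∀ t ∈ Icc (0 : ℝ) 1, f t ∈ Icc (0 : ℝ) 1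
  row_pos : ∀ e : ℕ, e < 2 → ∀ r s : ℝ, 0 < s → α * s ≤ r → 0 < r * A e 0 1 + s * A e 1 1
  row_le : ∀ e : ℕ, e < 2 → ∀ r s : ℝ, 0 < s → α * s ≤ r →
    α * (r * A e 0 1 + s * A e 1 1) ≤ r * A e 0 0 + s * A e 1 0
  alpha_gt : -1 < α
  alpha_le : α ≤ 0
  gamma_gt : 1 < γ
  zero : f 0 = 0
  one : f 1 = 1
  half : f (1 / 2) = 1 / γ
  mono : MonotoneOn f (Icc 0 1)

/-- `M` is the matrix product attached to the dyadic interval `[j / 2 ^ m, (j + 1) / 2 ^ m)`. -/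
structure IsCylinder (A : ℕ → Matrix (Fin 2) (Fin 2) ℝ) (f : ℝ → ℝ) (α : ℝ) (m j : ℕ)
    (M : Matrix (Fin 2) (Fin 2) ℝ) : Prop where
  prod : ∀ t ∈ Ico (0 : ℝ) 1, matProd A ((j + t) / 2 ^ m) m = M
  val : ∀ t ∈ Icc (0 : ℝ) 1, f ((j + t) / 2 ^ m) = PhiM M (f t)
  pos : 0 < M 1 1
  low : α * M 1 1 ≤ M 1 0
  lt : j < 2 ^ m

lemma Xdig_dyadic (m j e : ℕ) (he : e < 2) (t : ℝ) (ht : t ∈ Ico (0 : ℝ) 1) :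
    Xdig (((2 * j + e : ℕ) + t) / 2 ^ (m + 1)) (m + 1) = e := by
  have h1 : (2 : ℝ) ^ (m + 1) * (((2 * j + e : ℕ) + t) / 2 ^ (m + 1)) = t + (2 * j + e : ℕ) := by
    field_simp; ring
  have h2 : (2 : ℝ) ^ m * (((2 * j + e : ℕ) + t) / 2 ^ (m + 1)) = (e + t) / 2 + (j : ℕ) := by
    push_cast; field_simp; ring
  have he' : (e : ℝ) ≤ 1 := by exact_mod_cast Nat.lt_succ_iff.mp he
  have he0 : (0 : ℝ) ≤ e := Nat.cast_nonneg e
  unfold Xdig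
  rw [Nat.add_sub_cancel, h1, h2, Nat.floor_add_natCast ht.1,
    Nat.floor_add_natCast (by linarith [ht.1]), Nat.floor_eq_zero.2 ht.2,
    Nat.floor_eq_zero.2 (by linarith [ht.2])]
  omega

lemma IsCylinder.root {A : ℕ → Matrix (Fin 2) (Fin 2) ℝ} {f : ℝ → ℝ} {γ α : ℝ}
    (h : DeRhamSystem A f γ α) : IsCylinder A f α 0 0 1 where
  prod := by simp [matProd]
  val := by simp [PhiM]
  pos := by simp
  low := by simpa using h.alpha_le
  lt := by simp

lemma IsCylinder.child {A : ℕ → Matrix (Fin 2) (Fin 2) ℝ} {f : ℝ → ℝ} {γ α : ℝ}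
    (h : DeRhamSystem A f γ α) {m j : ℕ} {M : Matrix (Fin 2) (Fin 2) ℝ}
    (hM : IsCylinder A f α m j M) {e : ℕ} (he : e < 2) :
    IsCylinder A f α (m + 1) (2 * j + e) (M * A e) := by
  have he' : (e : ℝ) ≤ 1 := by exact_mod_cast Nat.lt_succ_iff.mp he
  have he0 : (0 : ℝ) ≤ e := Nat.cast_nonneg e
  have hx : ∀ t : ℝ, ((2 * j + e : ℕ) + t) / 2 ^ (m + 1) = (j + (e + t) / 2) / 2 ^ m := by
    intro t; push_cast; field_simp; ring
  refine ⟨fun t ht => ?_, fun t ht => ?_, ?_, ?_, ?_⟩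
  · rw [matProd_succ, Xdig_dyadic m j e he t ht, hx,
      hM.prod _ ⟨by linarith [ht.1], by linarith [ht.2]⟩]
  · rw [hx, hM.val _ ⟨by linarith [ht.1], by linarith [ht.2]⟩, h.eqn e he t ht,
      PhiM_mul _ _ _ (h.den e he _ (h.maps t ht)).ne']
  · simpa [Matrix.mul_apply, Fin.sum_univ_two] using h.row_pos e he _ _ hM.pos hM.low
  · simpa [Matrix.mul_apply, Fin.sum_univ_two] using h.row_le e he _ _ hM.pos hM.low
  · have := hM.lt
    rw [pow_succ]; omega

lemma IsCylinder.split {A : ℕ → Matrix (Fin 2) (Fin 2) ℝ} {f : ℝ → ℝ} {γ α : ℝ}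
    (h : DeRhamSystem A f γ α) {m j : ℕ} {M : Matrix (Fin 2) (Fin 2) ℝ}
    (hM : IsCylinder A f α m j M) :
    f ((2 * j + 1) / 2 ^ (m + 1)) - f (j / 2 ^ m) =
      (M 1 0 / M 1 1 + 1) / (M 1 0 / M 1 1 + γ) * (f ((j + 1) / 2 ^ m) - f (j / 2 ^ m)) := by
  have v0 := hM.val 0 (by simp)
  have v1 := hM.val 1 (by simp)
  have v2 := hM.val (1 / 2) (by constructor <;> norm_num)
  have hx : ((2 * j + 1) / 2 ^ (m + 1) : ℝ) = (j + 1 / 2) / 2 ^ m := by field_simp; ring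
  rw [add_zero] at v0
  rw [hx, v0, v1, v2, h.zero, h.one, h.half]
  have hs := hM.pos
  have hr : 0 < M 1 0 + M 1 1 := by nlinarith [hM.low, h.alpha_gt]
  have hg := h.gamma_gt
  have hrg : 0 < M 1 0 + M 1 1 * γ := by nlinarith
  have e1 : (M 1 0 / M 1 1 + 1) / (M 1 0 / M 1 1 + γ) = (M 1 0 + M 1 1) / (M 1 0 + M 1 1 * γ) := by
    rw [← mul_div_mul_right _ _ hs.ne']; congr 1 <;> (field_simp)
  have e2 : PhiM M (1 / γ) = (M 0 0 + M 0 1 * γ) / (M 1 0 + M 1 1 * γ) := by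
    unfold PhiM
    rw [← mul_div_mul_right _ _ (by positivity : γ ≠ 0)]; congr 1 <;> (field_simp)
  rw [e1, e2]
  simp only [PhiM, mul_zero, zero_add, mul_one]
  generalize M 0 0 = p, M 0 1 = q, M 1 0 = r, M 1 1 = s at *
  have hrs : r + s * γ ≠ 0 := hrg.ne'
  have hrs' : r + s ≠ 0 := hr.ne'
  rw [div_sub_div _ _ hrs hs.ne', div_sub_div _ _ hrs' hs.ne', div_mul_div_comm,
    div_eq_div_iff (mul_ne_zero hrs hs.ne') (mul_ne_zero hrs (mul_ne_zero hrs' hs.ne'))]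
  ring

lemma lintegral_cylinder_le {A : ℕ → Matrix (Fin 2) (Fin 2) ℝ} {f : ℝ → ℝ} {γ α : ℝ}
    (h : DeRhamSystem A f γ α) (μ : Measure ℝ)
    (hμ : ∀ u v : ℝ, 0 ≤ u → u ≤ v → v ≤ 1 → μ (Ico u v) = ENNReal.ofReal (f v - f u))
    (g : ℝ → ℝ) (hg1 : ∀ z, g z ≤ 1) (ρ : ℝ) (hρ : 0 ≤ ρ)
    (hstep : ∀ z z' : ℝ, α ≤ z → Real.exp (-g z) *
      ((z + 1) / (z + γ) * Real.exp ((1 - g (PhiM (A 0)ᵀ z)) / 2) +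
        (1 - (z + 1) / (z + γ)) * Real.exp ((1 - g z') / 2)) ≤ ρ * Real.exp ((1 - g z) / 2))
    (n : ℕ) : ∀ (m j : ℕ) (M : Matrix (Fin 2) (Fin 2) ℝ), IsCylinder A f α m j M →
    ∫⁻ x in Ico ((j : ℝ) / 2 ^ m) ((j + 1) / 2 ^ m),
        ENNReal.ofReal (Real.exp (-∑ i ∈ Finset.range n, g (rowRatio A x (m + i)))) ∂μ ≤
      ENNReal.ofReal (ρ ^ n * Real.exp ((1 - g (M 1 0 / M 1 1)) / 2) *
        (f ((j + 1) / 2 ^ m) - f (j / 2 ^ m))) := by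
  have hdy : ∀ m j : ℕ, j ≤ 2 ^ m → (j : ℝ) / 2 ^ m ∈ Icc (0 : ℝ) 1 := fun m j hj =>
    ⟨by positivity, div_le_one_of_le₀ (by exact_mod_cast hj) (by positivity)⟩
  induction n with
  | zero =>
    intro m j M hM
    have h0 := hdy m j hM.lt.le
    have h1 := hdy m (j + 1) hM.lt
    push_cast at h1
    have h01 : (j : ℝ) / 2 ^ m ≤ (j + 1) / 2 ^ m := by gcongr; linarith
    simp only [Finset.range_zero, Finset.sum_empty, neg_zero, Real.exp_zero, ENNReal.ofReal_one,
      lintegral_const, Measure.restrict_apply_univ, one_mul, pow_zero]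
    rw [hμ _ _ h0.1 h01 h1.2]
    apply ENNReal.ofReal_le_ofReal
    have : 1 ≤ Real.exp ((1 - g (M 1 0 / M 1 1)) / 2) :=
      Real.one_le_exp (by linarith [hg1 (M 1 0 / M 1 1)])
    nlinarith [h.mono h0 h1 h01]
  | succ n ih =>
    intro m j M hM
    have h0 := hdy m j hM.lt.le
    have h1 := hdy m (j + 1) hM.lt
    push_cast at h1
    set z := M 1 0 / M 1 1 with hz
    have hconst : ∀ x ∈ Ico ((j : ℝ) / 2 ^ m) ((j + 1) / 2 ^ m), rowRatio A x m = z := by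
      intro x hx
      have hxt : x = (j + (2 ^ m * x - j)) / 2 ^ m := by field_simp; ring
      have e1 := hx.1
      have e2 := hx.2
      rw [div_le_iff₀ (by positivity)] at e1
      rw [lt_div_iff₀ (by positivity)] at e2
      rw [rowRatio, hxt, hM.prod _ ⟨by linarith, by linarith⟩]
    have hsum : ∀ x, ∑ i ∈ Finset.range (n + 1), g (rowRatio A x (m + i)) =
        g (rowRatio A x m) + ∑ i ∈ Finset.range n, g (rowRatio A x (m + 1 + i)) := by
      intro x
      rw [Finset.sum_range_succ', add_comm]
      simp only [add_zero]
      congr 1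
      exact Finset.sum_congr rfl fun i _ => by congr 2; omega
    have hA0 : ((2 * j + 0 : ℕ) : ℝ) / 2 ^ (m + 1) = j / 2 ^ m := by push_cast; field_simp; ring
    have hA1 : (((2 * j + 0 : ℕ) : ℝ) + 1) / 2 ^ (m + 1) = (2 * j + 1) / 2 ^ (m + 1) := by
      push_cast; ring
    have hB0 : ((2 * j + 1 : ℕ) : ℝ) / 2 ^ (m + 1) = (2 * j + 1) / 2 ^ (m + 1) := by push_cast; ring
    have hB1 : (((2 * j + 1 : ℕ) : ℝ) + 1) / 2 ^ (m + 1) = (j + 1) / 2 ^ m := by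
      push_cast; field_simp; ring
    have hle0 : (j : ℝ) / 2 ^ m ≤ (2 * j + 1) / 2 ^ (m + 1) := by
      rw [div_le_div_iff₀ (by positivity) (by positivity), pow_succ]
      nlinarith [pow_pos (two_pos : (0 : ℝ) < 2) m]
    have hle1 : (2 * j + 1) / 2 ^ (m + 1) ≤ ((j : ℝ) + 1) / 2 ^ m := by
      rw [div_le_div_iff₀ (by positivity) (by positivity), pow_succ]
      nlinarith [pow_pos (two_pos : (0 : ℝ) < 2) m]
    have i0 := ih _ _ _ (hM.child h (e := 0) (by norm_num))
    have i1 := ih _ _ _ (hM.child h (e := 1) (by norm_num))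
    rw [hA0, hA1] at i0
    rw [hB0, hB1] at i1
    have hzA : (M * A 0) 1 0 / (M * A 0) 1 1 = PhiM (A 0)ᵀ z := by
      have hs := hM.pos
      symm
      unfold PhiM
      rw [← mul_div_mul_right _ _ hs.ne', hz]
      simp only [Matrix.mul_apply, Fin.sum_univ_two, Matrix.transpose_apply]
      congr 1 <;> (field_simp)
    rw [hzA] at i0
    have hD : 0 ≤ f ((j + 1) / 2 ^ m) - f (j / 2 ^ m) :=
      sub_nonneg.2 (h.mono h0 h1 (hle0.trans hle1))
    have hD0 : 0 ≤ f ((2 * j + 1) / 2 ^ (m + 1)) - f (j / 2 ^ m) :=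
      sub_nonneg.2 (h.mono h0 ⟨by positivity, hle1.trans h1.2⟩ hle0)
    have hD1 : 0 ≤ f ((j + 1) / 2 ^ m) - f ((2 * j + 1) / 2 ^ (m + 1)) :=
      sub_nonneg.2 (h.mono ⟨by positivity, hle1.trans h1.2⟩ h1 hle1)
    have hαz : α ≤ z := (le_div_iff₀ hM.pos).2 hM.low
    have hsp := hM.split h
    rw [← hz] at hsp
    calc ∫⁻ x in Ico ((j : ℝ) / 2 ^ m) ((j + 1) / 2 ^ m),
          ENNReal.ofReal (Real.exp (-∑ i ∈ Finset.range (n + 1), g (rowRatio A x (m + i)))) ∂μ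
        = ∫⁻ x in Ico ((j : ℝ) / 2 ^ m) ((j + 1) / 2 ^ m), ENNReal.ofReal (Real.exp (-g z)) *
          ENNReal.ofReal (Real.exp (-∑ i ∈ Finset.range n, g (rowRatio A x (m + 1 + i)))) ∂μ := by
          refine setLIntegral_congr_fun measurableSet_Ico fun x hx => ?_
          rw [hsum, hconst x hx, neg_add, Real.exp_add, ENNReal.ofReal_mul (Real.exp_pos _).le]
      _ = ENNReal.ofReal (Real.exp (-g z)) *
          (∫⁻ x in Ico ((j : ℝ) / 2 ^ m) ((2 * j + 1) / 2 ^ (m + 1)),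
            ENNReal.ofReal (Real.exp (-∑ i ∈ Finset.range n, g (rowRatio A x (m + 1 + i)))) ∂μ +
          ∫⁻ x in Ico (((2 : ℝ) * j + 1) / 2 ^ (m + 1)) ((j + 1) / 2 ^ m),
            ENNReal.ofReal (Real.exp (-∑ i ∈ Finset.range n, g (rowRatio A x (m + 1 + i)))) ∂μ) := by
          rw [lintegral_const_mul' _ _ ENNReal.ofReal_ne_top, ← Ico_union_Ico_eq_Ico hle0 hle1,
            lintegral_union measurableSet_Ico]
          exact Set.disjoint_left.2 fun x hx hx' => absurd hx.2 (not_lt.2 hx'.1)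
      _ ≤ _ := by
          refine (mul_le_mul_right (add_le_add i0 i1) _).trans ?_
          rw [← ENNReal.ofReal_add (by positivity) (by positivity),
            ← ENNReal.ofReal_mul (Real.exp_pos _).le]
          apply ENNReal.ofReal_le_ofReal
          have hD1' : f ((j + 1) / 2 ^ m) - f ((2 * j + 1) / 2 ^ (m + 1)) =
              (1 - (z + 1) / (z + γ)) * (f ((j + 1) / 2 ^ m) - f (j / 2 ^ m)) := by
            linear_combination -hsp
          rw [hsp, hD1']
          have key := mul_le_mul_of_nonneg_right
            (hstep z ((M * A 1) 1 0 / (M * A 1) 1 1) hαz) (mul_nonneg (pow_nonneg hρ n) hD)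
          calc _ = _ := by ring
            _ ≤ _ := key
            _ = _ := by ring

/-- Almost surely, the averages of `g` along the ratios `r_n / s_n` stay above a positive constant. -/
lemma ae_eventually_lt_sum {A : ℕ → Matrix (Fin 2) (Fin 2) ℝ} {f : ℝ → ℝ} {γ α : ℝ}
    (h : DeRhamSystem A f γ α) (μ : Measure ℝ)
    (hμ : ∀ u v : ℝ, 0 ≤ u → u ≤ v → v ≤ 1 → μ (Ico u v) = ENNReal.ofReal (f v - f u))
    (g : ℝ → ℝ) (hgm : Measurable g) (hg0 : ∀ z, 0 ≤ g z) (hg1 : ∀ z, g z ≤ 1)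
    (ρ : ℝ) (hρ : 0 < ρ) (hρ1 : ρ < 1)
    (hstep : ∀ z z' : ℝ, α ≤ z → Real.exp (-g z) *
      ((z + 1) / (z + γ) * Real.exp ((1 - g (PhiM (A 0)ᵀ z)) / 2) +
        (1 - (z + 1) / (z + γ)) * Real.exp ((1 - g z') / 2)) ≤ ρ * Real.exp ((1 - g z) / 2)) :
    ∃ c : ℝ, 0 < c ∧ ∀ᵐ x ∂μ, x ∈ Ico (0 : ℝ) 1 → ∀ᶠ n : ℕ in atTop,
      c * n < ∑ i ∈ Finset.range n, g (rowRatio A x i) := by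
  have hlog := Real.log_neg hρ hρ1
  refine ⟨-Real.log ρ / 2, by linarith, ?_⟩
  set c := -Real.log ρ / 2 with hc
  set θ := ρ * Real.exp c with hθ
  have hθ1 : θ < 1 := by
    rw [hθ]; nth_rewrite 1 [← Real.exp_log hρ]
    rw [← Real.exp_add, Real.exp_lt_one_iff]; linarith
  have hθ0 : 0 ≤ θ := by positivity
  set C := Real.exp (1 / 2) with hC
  have hbound : ∀ n : ℕ, μ ({x | ∑ i ∈ Finset.range n, g (rowRatio A x i) ≤ c * n} ∩ Ico 0 1) ≤
      ENNReal.ofReal (C * θ ^ n) := by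
    intro n
    have hI := lintegral_cylinder_le h μ hμ g hg1 ρ hρ.le hstep n 0 0 1 (IsCylinder.root h)
    simp only [Nat.cast_zero, pow_zero, zero_add, div_one, h.zero, h.one, sub_zero, mul_one] at hI
    have hmeas : Measurable fun x : ℝ => ENNReal.ofReal
        (Real.exp (-∑ i ∈ Finset.range n, g (rowRatio A x i))) :=
      ENNReal.measurable_ofReal.comp (Real.measurable_exp.comp
        (Finset.measurable_fun_sum _ fun i _ => hgm.comp (measurable_rowRatio A i)).neg)
    have hmk := mul_meas_ge_le_lintegral₀ (μ := μ.restrict (Ico 0 1)) hmeas.aemeasurable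
      (ENNReal.ofReal (Real.exp (-(c * n))))
    have hsub : {x | ∑ i ∈ Finset.range n, g (rowRatio A x i) ≤ c * n} ⊆
        {x | ENNReal.ofReal (Real.exp (-(c * n))) ≤ ENNReal.ofReal
          (Real.exp (-∑ i ∈ Finset.range n, g (rowRatio A x i)))} := by
      intro x hx
      exact ENNReal.ofReal_le_ofReal (Real.exp_le_exp.2 (neg_le_neg hx))
    have h1 : ENNReal.ofReal (Real.exp (-(c * n))) *
        μ ({x | ∑ i ∈ Finset.range n, g (rowRatio A x i) ≤ c * n} ∩ Ico 0 1) ≤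
        ENNReal.ofReal (ρ ^ n * C) := by
      rw [← Measure.restrict_apply' measurableSet_Ico]
      refine (mul_le_mul_right (measure_mono hsub) _).trans (hmk.trans (hI.trans ?_))
      refine ENNReal.ofReal_le_ofReal (mul_le_mul_of_nonneg_left ?_ (by positivity))
      rw [hC, Real.exp_le_exp]
      linarith [hg0 ((1 : Matrix (Fin 2) (Fin 2) ℝ) 1 0 / (1 : Matrix (Fin 2) (Fin 2) ℝ) 1 1)]
    have h2 : ENNReal.ofReal (Real.exp (c * n)) * ENNReal.ofReal (Real.exp (-(c * n))) = 1 := by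
      rw [← ENNReal.ofReal_mul (Real.exp_pos _).le, ← Real.exp_add, add_neg_cancel, Real.exp_zero,
        ENNReal.ofReal_one]
    calc _ = ENNReal.ofReal (Real.exp (c * n)) * (ENNReal.ofReal (Real.exp (-(c * n))) *
        μ ({x | ∑ i ∈ Finset.range n, g (rowRatio A x i) ≤ c * n} ∩ Ico 0 1)) := by
          rw [← mul_assoc, h2, one_mul]
      _ ≤ ENNReal.ofReal (Real.exp (c * n)) * ENNReal.ofReal (ρ ^ n * C) := mul_le_mul_right h1 _
      _ = _ := by
          rw [← ENNReal.ofReal_mul (Real.exp_pos _).le, hθ, mul_pow, mul_comm c, Real.exp_nat_mul]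
          congr 1; ring
  have hsumm : Summable fun n : ℕ => C * θ ^ n :=
    (summable_geometric_of_lt_one hθ0 hθ1).mul_left C
  have hfin : ∑' n : ℕ, μ ({x | ∑ i ∈ Finset.range n, g (rowRatio A x i) ≤ c * n} ∩ Ico 0 1) ≠ ⊤ :=
    ne_top_of_le_ne_top hsumm.tsum_ofReal_ne_top (ENNReal.tsum_le_tsum hbound)
  filter_upwards [ae_eventually_notMem hfin] with x hx hx01
  filter_upwards [hx] with n hn
  by_contra hcon
  exact hn ⟨not_lt.1 hcon, hx01⟩

lemma measure_Ico_of_cdf (f : ℝ → ℝ) (hfc : ContinuousOn f (Icc 0 1))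
    (hf0 : f 0 = 0) (hfp : ∀ x ∈ Icc (0 : ℝ) 1, 0 ≤ f x) (μ : Measure ℝ) [IsFiniteMeasure μ]
    (hμ : ∀ x ∈ Icc (0 : ℝ) 1, μ (Iic x) = ENNReal.ofReal (f x))
    (u v : ℝ) (hu : 0 ≤ u) (huv : u ≤ v) (hv : v ≤ 1) :
    μ (Ico u v) = ENNReal.ofReal (f v - f u) := by
  have hIoc : ∀ u v : ℝ, 0 ≤ u → u ≤ v → v ≤ 1 → μ (Ioc u v) = ENNReal.ofReal (f v - f u) := by
    intro u v hu huv hv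
    rw [← Iic_sdiff_Iic, measure_sdiff (Iic_subset_Iic.2 huv) measurableSet_Iic.nullMeasurableSet
      (measure_ne_top _ _), hμ v ⟨hu.trans huv, hv⟩, hμ u ⟨hu, huv.trans hv⟩,
      ENNReal.ofReal_sub _ (hfp u ⟨hu, huv.trans hv⟩)]
  have hatom : ∀ x ∈ Icc (0 : ℝ) 1, μ {x} = 0 := by
    intro x hx
    rcases hx.1.eq_or_lt with h0 | h0
    · have : μ {x} ≤ μ (Iic x) := measure_mono (by simp)
      rw [hμ x hx, ← h0, hf0, ENNReal.ofReal_zero] at this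
      rw [← h0]; exact le_antisymm this zero_le
    · have hne : (nhdsWithin x (Ico 0 x)).NeBot := by
        rw [← mem_closure_iff_nhdsWithin_neBot, closure_Ico h0.ne]
        exact ⟨hx.1, le_rfl⟩
      have ht : Tendsto (fun y => ENNReal.ofReal (f x - f y)) (nhdsWithin x (Ico 0 x)) (nhds 0) := by
        have h1 : Tendsto f (nhdsWithin x (Ico 0 x)) (nhds (f x)) :=
          (hfc x hx).mono_left (nhdsWithin_mono _ fun y hy => ⟨hy.1, hy.2.le.trans hx.2⟩)
        have h2 := ENNReal.tendsto_ofReal (h1.const_sub (f x))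
        simpa using h2
      refine le_antisymm (ge_of_tendsto ht ?_) zero_le
      filter_upwards [self_mem_nhdsWithin] with y hy
      rw [← hIoc y x hy.1 hy.2.le hx.2]
      exact measure_mono (by simpa using hy.2)
  rw [← hIoc u v hu huv hv]
  refine measure_congr (Ico_ae_eq_Ioc' (hatom u ⟨hu, huv.trans hv⟩) (hatom v ⟨hu.trans huv, hv⟩))

lemma entS_eq_binEntropy (p : ℝ) : entS p = Real.binEntropy p := by
  simp only [entS, Real.binEntropy, Real.log_inv]; ring

lemma entS_le_log_two (p : ℝ) : entS p ≤ Real.log 2 := by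
  rw [entS_eq_binEntropy]; exact Real.binEntropy_le_log_two

lemma entS_nonneg {p : ℝ} (h0 : 0 ≤ p) (h1 : p ≤ 1) : 0 ≤ entS p := by
  rw [entS_eq_binEntropy]; exact Real.binEntropy_nonneg h0 h1

lemma exists_entS_le_log_two_sub {ε : ℝ} (hε : 0 < ε) (hε' : ε < 1 / 2) :
    ∃ η : ℝ, 0 < η ∧ ∀ p : ℝ, 0 ≤ p → p ≤ 1 → ε < |p - 1 / 2| → entS p ≤ Real.log 2 - η := by
  refine ⟨Real.log 2 - Real.binEntropy (1 / 2 - ε), ?_, fun p h0 h1 hp => ?_⟩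
  · rw [sub_pos, Real.binEntropy_lt_log_two]
    intro h; linarith
  · have key : ∀ q : ℝ, 0 ≤ q → q ≤ 1 / 2 - ε →
        Real.binEntropy q ≤ Real.binEntropy (1 / 2 - ε) := fun q hq0 hq =>
      Real.binEntropy_strictMonoOn.monotoneOn ⟨hq0, by linarith⟩
        ⟨by linarith, by linarith⟩ hq
    rw [entS_eq_binEntropy, sub_sub_cancel]
    rcases lt_abs.1 hp with h | h
    · rw [← Real.binEntropy_one_sub]
      exact key _ (by linarith) (by linarith)
    · exact key _ h0 (by linarith)

/-- If `T` does not fix `γ - 2`, then `(z + 1) / (z + γ)` and its value at `T z` cannot both be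
close to `1 / 2`. -/
lemma exists_transition_gap {γ α : ℝ} (hγ : 1 < γ) (hα : -1 < α) (T : ℝ → ℝ) (hT : Continuous T)
    (hmaps : ∀ z, -1 < z → -1 < T z) (hfix : T (γ - 2) ≠ γ - 2) :
    ∃ ε : ℝ, 0 < ε ∧ ε < 1 / 2 ∧ ∀ z, α ≤ z → |(z + 1) / (z + γ) - 1 / 2| ≤ ε →
      ε < |(T z + 1) / (T z + γ) - 1 / 2| := by
  set inv : ℝ → ℝ := fun p => (γ * p - 1) / (1 - p) with hinv
  have hinv0 : inv (1 / 2) = γ - 2 := by simp only [hinv]; ring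
  have hinvc : ContinuousAt inv (1 / 2) :=
    ContinuousAt.div (by fun_prop) (by fun_prop) (by norm_num)
  have hpos : 0 < T (γ - 2) + γ := by linarith [hmaps (γ - 2) (by linarith)]
  have hTc : ContinuousAt (fun p => T (inv p)) (1 / 2) := hT.continuousAt.comp hinvc
  have hG : ContinuousAt (fun p => |(T (inv p) + 1) / (T (inv p) + γ) - 1 / 2| - |p - 1 / 2|)
      (1 / 2) := by
    refine ContinuousAt.sub (((ContinuousAt.div (hTc.add continuousAt_const)
      (hTc.add continuousAt_const) ?_).sub continuousAt_const).abs) (by fun_prop)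
    show T (inv (1 / 2)) + γ ≠ 0
    rw [hinv0]; exact hpos.ne'
  have hval : 0 < |(T (γ - 2) + 1) / (T (γ - 2) + γ) - 1 / 2| := by
    rw [abs_pos, sub_ne_zero, Ne, div_eq_div_iff hpos.ne' two_ne_zero]
    intro h; exact hfix (by linarith)
  set κ := |(T (γ - 2) + 1) / (T (γ - 2) + γ) - 1 / 2| with hκ
  have hev : ∀ᶠ p in nhds (1 / 2 : ℝ),
      κ / 2 < |(T (inv p) + 1) / (T (inv p) + γ) - 1 / 2| - |p - 1 / 2| := by
    refine hG.eventually (lt_mem_nhds ?_)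
    simp only [hinv0, sub_self, abs_zero, sub_zero]
    linarith
  obtain ⟨r, hr, hball⟩ := Metric.eventually_nhds_iff.1 hev
  refine ⟨min (min (r / 2) (κ / 2)) (1 / 4), by positivity,
    (min_le_right _ _).trans_lt (by norm_num), fun z hz hp => ?_⟩
  have hzγ : 0 < z + γ := by linarith
  have hp1 : |(z + 1) / (z + γ) - 1 / 2| ≤ r / 2 :=
    hp.trans ((min_le_left _ _).trans (min_le_left _ _))
  have := hball (y := (z + 1) / (z + γ)) (by rw [Real.dist_eq]; linarith)
  have hinvz : inv ((z + 1) / (z + γ)) = z := by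
    have h1 : 1 - (z + 1) / (z + γ) = (γ - 1) / (z + γ) := by field_simp; ring
    have h2 : γ * ((z + 1) / (z + γ)) - 1 = (γ - 1) * z / (z + γ) := by field_simp; ring
    simp only [hinv]
    rw [h1, h2, div_div_div_cancel_right₀ hzγ.ne', mul_div_cancel_left₀ _ (by linarith)]
  rw [hinvz] at this
  have h3 : min (min (r / 2) (κ / 2)) (1 / 4) ≤ κ / 2 :=
    (min_le_left _ _).trans (min_le_right _ _)
  linarith [abs_nonneg ((z + 1) / (z + γ) - 1 / 2)]

lemma limsup_average_le {u v : ℕ → ℝ} {B η c : ℝ} (hη : 0 < η) (hc : 0 < c)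
    (hu0 : ∀ n, 0 ≤ u n) (huv : ∀ n, u n ≤ B - η * v n) (hv0 : v 0 ≤ 1)
    (hv : ∀ᶠ n : ℕ in atTop, c * n < ∑ i ∈ Finset.range n, v i) :
    limsup (fun N : ℕ => (∑ n ∈ Finset.Icc 1 N, u n) / N) atTop ≤ B - η * c / 2 := by
  refine limsup_le_of_le (isCoboundedUnder_le_of_le atTop (x := 0) fun N =>
    div_nonneg (Finset.sum_nonneg fun n _ => hu0 n) (Nat.cast_nonneg N)) ?_
  obtain ⟨K, hK⟩ := exists_nat_gt (2 / c)
  filter_upwards [(tendsto_add_atTop_nat 1).eventually hv, eventually_gt_atTop K] with N hN hNK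
  have hN0 : (0 : ℝ) < N := by exact_mod_cast (Nat.zero_le K).trans_lt hNK
  have hNc : 2 < c * N := by
    have : 2 / c < N := hK.trans (by exact_mod_cast hNK)
    rwa [div_lt_iff₀ hc, mul_comm] at this
  have hsum : ∑ n ∈ Finset.Icc 1 N, v n = ∑ i ∈ Finset.range (N + 1), v i - v 0 := by
    rw [Finset.sum_range_succ', Finset.range_eq_Ico, Finset.sum_Ico_add' v 0 N 1,
      add_sub_cancel_right]
    rfl
  rw [div_le_iff₀ hN0]
  calc ∑ n ∈ Finset.Icc 1 N, u n ≤ ∑ n ∈ Finset.Icc 1 N, (B - η * v n) :=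
        Finset.sum_le_sum fun n _ => huv n
    _ = N * B - η * (∑ i ∈ Finset.range (N + 1), v i - v 0) := by
        rw [Finset.sum_sub_distrib, ← Finset.mul_sum, hsum]; simp
    _ ≤ N * B - η * (c * N / 2) := by
        have : c * N / 2 ≤ ∑ i ∈ Finset.range (N + 1), v i - v 0 := by
          push_cast at hN; linarith
        gcongr
    _ = _ := by ring

lemma DeRhamSystem.le_rowRatio {A : ℕ → Matrix (Fin 2) (Fin 2) ℝ} {f : ℝ → ℝ} {γ α : ℝ}
    (h : DeRhamSystem A f γ α) {x : ℝ} (hx : x ∈ Ico (0 : ℝ) 1) (n : ℕ) :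
    α ≤ rowRatio A x n := by
  have hX : ∀ n, Xdig x (n + 1) < 2 := by
    intro n
    have h0 : (0 : ℝ) ≤ 2 ^ n * x := mul_nonneg (by positivity) hx.1
    have : ⌊(2 : ℝ) ^ (n + 1) * x⌋₊ < 2 * ⌊(2 : ℝ) ^ n * x⌋₊ + 2 := by
      rw [Nat.floor_lt (by rw [pow_succ]; linarith)]
      push_cast
      have := Nat.lt_floor_add_one ((2 : ℝ) ^ n * x)
      rw [pow_succ]; linarith
    unfold Xdig
    rw [Nat.add_sub_cancel]; omega
  have key : 0 < matProd A x n 1 1 ∧ α * matProd A x n 1 1 ≤ matProd A x n 1 0 := by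
    induction n with
    | zero => simpa [matProd] using h.alpha_le
    | succ n ih =>
      rw [matProd_succ]
      simp only [Matrix.mul_apply, Fin.sum_univ_two]
      exact ⟨h.row_pos _ (hX n) _ _ ih.1 ih.2, h.row_le _ (hX n) _ _ ih.1 ih.2⟩
  exact (le_div_iff₀ key.1).2 key.2

theorem exists_limsup_entS_le {A : ℕ → Matrix (Fin 2) (Fin 2) ℝ} {f : ℝ → ℝ} {γ α : ℝ}
    (h : DeRhamSystem A f γ α) (μ : Measure ℝ)
    (hμ : ∀ u v : ℝ, 0 ≤ u → u ≤ v → v ≤ 1 → μ (Ico u v) = ENNReal.ofReal (f v - f u))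
    (hT : Continuous (PhiM (A 0)ᵀ)) (hmaps : ∀ z, -1 < z → -1 < PhiM (A 0)ᵀ z)
    (hfix : PhiM (A 0)ᵀ (γ - 2) ≠ γ - 2) :
    ∃ δ : ℝ, 0 < δ ∧ ∀ᵐ x ∂μ, x ∈ Ico (0 : ℝ) 1 →
      limsup (fun N : ℕ => (∑ n ∈ Finset.Icc 1 N,
        entS ((rowRatio A x n + 1) / (rowRatio A x n + γ))) / N) atTop ≤ Real.log 2 - δ := by
  have hγ := h.gamma_gt
  have hα := h.alpha_gt
  obtain ⟨ε, hε, hε', hgap⟩ := exists_transition_gap hγ hα _ hT hmaps hfix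
  obtain ⟨η, hη, hent⟩ := exists_entS_le_log_two_sub hε hε'
  set S : Set ℝ := {z | ε < |(z + 1) / (z + γ) - 1 / 2|} with hS
  have hSm : MeasurableSet S := measurableSet_lt measurable_const
    ((((measurable_id.add_const 1).div (measurable_id.add_const γ)).sub_const _).abs)
  set g : ℝ → ℝ := S.indicator 1 with hg
  have hgS : ∀ z ∈ S, g z = 1 := fun z hz => by simp [hg, hz]
  have hgS' : ∀ z ∉ S, g z = 0 := fun z hz => by simp [hg, hz]
  have hg0 : ∀ z, 0 ≤ g z := fun z => indicator_nonneg (fun _ _ => zero_le_one) z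
  have hg1 : ∀ z, g z ≤ 1 := fun z => by
    by_cases hz : z ∈ S
    · exact (hgS z hz).le
    · rw [hgS' z hz]; exact zero_le_one
  have hp0 : ∀ z, α ≤ z → 0 ≤ (z + 1) / (z + γ) := fun z hz =>
    div_nonneg (by linarith) (by linarith)
  have hp1 : ∀ z, α ≤ z → (z + 1) / (z + γ) ≤ 1 := fun z hz => by
    rw [div_le_one (by linarith)]; linarith
  have hpα : ∀ z, α ≤ z → (α + 1) / (α + γ) ≤ (z + 1) / (z + γ) := fun z hz => by
    rw [div_le_div_iff₀ (by linarith) (by linarith)]; nlinarith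
  have hpα0 : 0 < (α + 1) / (α + γ) := div_pos (by linarith) (by linarith)
  have hpα1 := hp1 α le_rfl
  set π := (α + 1) / (α + γ) with hπ
  set E := Real.exp (1 / 2) with hE
  have hE1 : 1 < E := Real.one_lt_exp_iff.2 (by norm_num)
  have hEinv : Real.exp (-1) * E = E⁻¹ := by
    rw [hE, ← Real.exp_neg, ← Real.exp_add]; norm_num
  have hEi1 : E⁻¹ < 1 := inv_lt_one_of_one_lt₀ hE1
  have hEi0 : 0 < E⁻¹ := by positivity
  have hV : ∀ z, Real.exp ((1 - g z) / 2) ≤ E := fun z =>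
    Real.exp_le_exp.2 (by linarith [hg0 z])
  have hρle : E⁻¹ ≤ 1 - π * (1 - E⁻¹) := by nlinarith
  obtain ⟨c, hc, hae⟩ := ae_eventually_lt_sum h μ hμ g (measurable_one.indicator hSm) hg0 hg1
    (1 - π * (1 - E⁻¹)) (by linarith) (by nlinarith) (by
      intro z z' hz
      have a0 := hp0 z hz
      have a1 := hp1 z hz
      have aα := hpα z hz
      set p := (z + 1) / (z + γ) with hp
      by_cases hzS : z ∈ S
      · rw [hgS z hzS, sub_self, zero_div, Real.exp_zero, mul_one]
        refine le_trans ?_ hρle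
        rw [← hEinv]
        refine mul_le_mul_of_nonneg_left ?_ (Real.exp_pos _).le
        nlinarith [hV (PhiM (A 0)ᵀ z), hV z']
      · have hTz : PhiM (A 0)ᵀ z ∈ S := hgap z hz (not_lt.1 hzS)
        rw [hgS' z hzS, hgS _ hTz, sub_self, zero_div, neg_zero, Real.exp_zero, sub_zero, ← hE]
        have h1 : (1 - π * (1 - E⁻¹)) * E = E - π * (E - 1) := by field_simp
        rw [h1]
        nlinarith [hV z'])
  refine ⟨η * c / 2, by positivity, ?_⟩
  filter_upwards [hae] with x hx hx01
  have hle := h.le_rowRatio hx01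
  refine limsup_average_le hη hc (v := fun n => g (rowRatio A x n))
    (fun n => entS_nonneg (hp0 _ (hle n)) (hp1 _ (hle n))) (fun n => ?_) (hg1 _) (hx hx01)
  by_cases hz : rowRatio A x n ∈ S
  · simp only [hgS _ hz, mul_one]
    exact hent _ (hp0 _ (hle n)) (hp1 _ (hle n)) hz
  · simp only [hgS' _ hz, mul_zero, sub_zero]
    exact entS_le_log_two _

theorem stmt16
    (a0 b0 c0 d0 a1 b1 c1 d1 : ℝ)
    (hb0 : b0 = 0)
    (hA1a : 0 < (a0 + b0) / (c0 + d0))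
    (hA1b : (a0 + b0) / (c0 + d0) = b1 / d1)
    (hA1c : b1 / d1 < (a1 + b1) / (c1 + d1))
    (hA1d : (a1 + b1) / (c1 + d1) = 1)
    (hA20 : 0 < a0 * d0 - b0 * c0)
    (hA21 : 0 < a1 * d1 - b1 * c1)
    (hA30 : Real.sqrt (a0 * d0 - b0 * c0) < min d0 (c0 + d0))
    (hA31 : Real.sqrt (a1 * d1 - b1 * c1) < min d1 (c1 + d1))
    (f : ℝ → ℝ)
    (hfc : ContinuousOn f (Set.Icc 0 1))
    (hfm : StrictMonoOn f (Set.Icc 0 1))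
    (hf0 : f 0 = 0) (hf1 : f 1 = 1)
    (hdR0 : ∀ x ∈ Set.Icc (0 : ℝ) (1 / 2), f x = Phi a0 b0 c0 d0 (f (2 * x)))
    (hdR1 : ∀ x ∈ Set.Icc (1 / 2 : ℝ) 1, f x = Phi a1 b1 c1 d1 (f (2 * x - 1)))
    (μf : Measure ℝ) [IsProbabilityMeasure μf]
    (hμf : ∀ x ∈ Set.Icc (0 : ℝ) 1, μf (Set.Iic x) = ENNReal.ofReal (f x))
    (γ : ℝ) (hγ : γ = 1 / Phi a0 b0 c0 d0 1)
    (α : ℝ) (hα : α = min (min 0 (c0 / (d0 - a0))) (c1 / b1))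
    (A : ℕ → Matrix (Fin 2) (Fin 2) ℝ)
    (hAm0 : A 0 = !![a0, b0; c0, d0])
    (hAm1 : A 1 = !![a1, b1; c1, d1])
    (hfail : (c0 + d0 - 2 * a0) * (d0 - a0) ≠ a0 * c0) :
    ∃ δ : ℝ, 0 < δ ∧
      ∀ᵐ x ∂μf, x ∈ Set.Ico (0 : ℝ) 1 →
        Filter.limsup (fun N : ℕ =>
          (∑ n ∈ Finset.Icc 1 N, entS ((matProd A x n 1 0 / matProd A x n 1 1 + 1) / (matProd A x n 1 0 / matProd A x n 1 1 + γ))) / N)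
          Filter.atTop ≤ Real.log 2 - δ := by
  subst hb0
  simp only [add_zero, zero_mul, sub_zero] at *
  obtain ⟨hs0, hs0'⟩ := lt_min_iff.1 hA30
  obtain ⟨hs1, hs1'⟩ := lt_min_iff.1 hA31
  have hd0 : 0 < d0 := (Real.sqrt_nonneg _).trans_lt hs0
  have hcd0 : 0 < c0 + d0 := (Real.sqrt_nonneg _).trans_lt hs0'
  have hd1 : 0 < d1 := (Real.sqrt_nonneg _).trans_lt hs1
  have hcd1 : 0 < c1 + d1 := (Real.sqrt_nonneg _).trans_lt hs1'
  rw [Real.sqrt_lt' hd0] at hs0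
  rw [Real.sqrt_lt' hcd1] at hs1'
  have ha0 : 0 < a0 := by
    rw [div_pos_iff_of_pos_right hcd0] at hA1a; exact hA1a
  have had0 : a0 < d0 := by nlinarith
  have hb1 : 0 < b1 := by
    rw [hA1b, div_pos_iff_of_pos_right hd1] at hA1a; exact hA1a
  rw [hA1d, div_lt_one hd1] at hA1c
  rw [div_eq_one_iff_eq hcd1.ne'] at hA1d
  have hacd0 : a0 < c0 + d0 := by
    have : a0 / (c0 + d0) < 1 := by rw [hA1b, div_lt_one hd1]; exact hA1c
    rwa [div_lt_one hcd0] at this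
  have ha1 : a1 = c1 + d1 - b1 := by linarith
  subst ha1
  have hbc1 : 0 < b1 + c1 := by nlinarith
  have hγ' : γ = (c0 + d0) / a0 := by rw [hγ]; simp [Phi]
  have hγ1 : 1 < γ := by rw [hγ', one_lt_div ha0]; exact hacd0
  have hα0 : α ≤ 0 := by rw [hα]; exact (min_le_left _ _).trans (min_le_left _ _)
  have hαc0 : α * (d0 - a0) ≤ c0 := by
    rw [← le_div_iff₀ (by linarith), hα]; exact (min_le_left _ _).trans (min_le_right _ _)
  have hαc1 : α * b1 ≤ c1 := by
    rw [← le_div_iff₀ hb1, hα]; exact min_le_right _ _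
  have hα1 : -1 < α := by
    rw [hα, lt_min_iff, lt_min_iff, lt_div_iff₀ (by linarith), lt_div_iff₀ hb1]
    exact ⟨⟨by norm_num, by linarith⟩, by linarith⟩
  have hmaps : ∀ t ∈ Icc (0 : ℝ) 1, f t ∈ Icc (0 : ℝ) 1 := fun t ht => by
    have h1 := hfm.monotoneOn (left_mem_Icc.2 zero_le_one) ht ht.1
    have h2 := hfm.monotoneOn ht (right_mem_Icc.2 zero_le_one) ht.2
    rw [hf0] at h1
    rw [hf1] at h2
    exact ⟨h1, h2⟩
  have hden : ∀ c d : ℝ, 0 < d → 0 < c + d → ∀ y ∈ Icc (0 : ℝ) 1, 0 < c * y + d := by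
    intro c d hd hcd y hy
    rcases le_total 0 c with hc | hc
    · linarith [mul_nonneg hc hy.1]
    · linarith [mul_le_mul_of_nonpos_left hy.2 hc]
  have hsys : DeRhamSystem A f γ α := by
    refine ⟨fun e he t ht => ?_, fun e he y hy => ?_, hmaps, fun e he r s hs hr => ?_,
      fun e he r s hs hr => ?_, hα1, hα0, hγ1, hf0, hf1, ?_, hfm.monotoneOn⟩
    · interval_cases e
      · rw [hAm0]
        have := hdR0 ((0 + t) / 2) ⟨by linarith [ht.1], by linarith [ht.2]⟩
        simpa [Phi, PhiM, mul_div_cancel₀] using this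
      · rw [hAm1]
        have := hdR1 ((1 + t) / 2) ⟨by linarith [ht.1], by linarith [ht.2]⟩
        rw [show 2 * ((1 + t) / 2) - 1 = t by ring] at this
        simpa [Phi, PhiM] using this
    · interval_cases e
      · simp only [hAm0, Matrix.of_apply, Matrix.cons_val]
        exact hden _ _ hd0 hcd0 y hy
      · simp only [hAm1, Matrix.of_apply, Matrix.cons_val]
        exact hden _ _ hd1 hcd1 y hy
    · have hrs : 0 < r + s := by nlinarith only [hr, hs, hα1]
      interval_cases e
      · simp only [hAm0, Matrix.of_apply, Matrix.cons_val]
        linarith [mul_pos hs hd0]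
      · simp only [hAm1, Matrix.of_apply, Matrix.cons_val]
        linarith [mul_pos hrs hb1, mul_pos hs (sub_pos.2 hA1c)]
    · interval_cases e
      · simp only [hAm0, Matrix.of_apply, Matrix.cons_val]
        have h1 : 0 ≤ (r - α * s) * a0 := mul_nonneg (by linarith) ha0.le
        have h2 : 0 ≤ s * (c0 - α * (d0 - a0)) := mul_nonneg hs.le (by linarith)
        linarith
      · simp only [hAm1, Matrix.of_apply, Matrix.cons_val]
        have h1 : 0 ≤ (r - α * s) * (c1 + d1 - b1 - α * b1) :=
          mul_nonneg (by linarith) (by linarith)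
        have h2 : 0 ≤ s * ((c1 - α * b1) * (α + 1)) :=
          mul_nonneg hs.le (mul_nonneg (by linarith) (by linarith))
        linarith
    · have := hdR0 (1 / 2) ⟨by norm_num, le_rfl⟩
      rw [this, hγ, one_div_one_div, mul_one_div_cancel two_ne_zero, hf1]
  have hTz : ∀ z, PhiM (A 0)ᵀ z = (a0 * z + c0) / d0 := fun z => by
    simp [PhiM, hAm0]
  refine exists_limsup_entS_le hsys μf
    (measure_Ico_of_cdf f hfc hf0 (fun x hx => (hmaps x hx).1) μf hμf) ?_ ?_ ?_
  · rw [show PhiM (A 0)ᵀ = fun z => (a0 * z + c0) / d0 from funext hTz]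
    fun_prop
  · intro z hz
    rw [hTz, lt_div_iff₀ hd0]
    nlinarith only [hz, ha0, hacd0]
  · rw [hTz, Ne, div_eq_iff hd0.ne']
    intro h
    have hγa : γ * a0 = c0 + d0 := by rw [hγ']; field_simp
    apply hfail
    linear_combination (-a0) * h + (a0 - d0) * hγa
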